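/- arXiv:2104.07167 — 5 statements merged into one kernel-verified Lean document; each statement's English description precedes it below -/
import Mathlib

section
/- Let A be a square real matrix that is skew-symmetric, i.e., Aᵀ = −A. Then I + A is invertible, and the matrix Q = (I − A)·(I + A)⁻¹ is orthogonal: QᵀQ = I and QQᵀ = I. -/
open Matrix

/-- The quadratic form of a real skew-symmetric matrix vanishes. -/
theorem dotProduct_mulVec_self_of_transpose_eq_neg {n : Type*} [Fintype n]
    {A : Matrix n n ℝ} (hA : Aᵀ = -A) (v : n → ℝ) : v ⬝ᵥ A *ᵥ v = 0 := by
  have h : v ⬝ᵥ A *ᵥ v = -(v ⬝ᵥ A *ᵥ v) := by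
    conv_lhs => rw [dotProduct_mulVec, ← mulVec_transpose, hA, neg_mulVec, neg_dotProduct,
      dotProduct_comm]
  linarith

theorem isUnit_one_add_of_transpose_eq_neg {n : Type*} [Fintype n] [DecidableEq n]
    {A : Matrix n n ℝ} (hA : Aᵀ = -A) : IsUnit (1 + A) := by
  rw [← mulVec_injective_iff_isUnit]
  refine (injective_iff_map_eq_zero (1 + A).mulVecLin).2 fun v hv => ?_
  rw [mulVecLin_apply] at hv
  have h := congrArg (v ⬝ᵥ ·) hv
  simpa [add_mulVec, dotProduct_add, dotProduct_mulVec_self_of_transpose_eq_neg hA] using h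

/-- for a real skew-symmetric matrix `A`, `I + A` is invertible and the
Cayley transform `Q = (I − A)(I + A)⁻¹` is orthogonal. -/
theorem cayley_of_skewSymmetric_orthogonal {n : Type*} [Fintype n] [DecidableEq n]
    (A : Matrix n n ℝ) (hA : Aᵀ = -A) :
    IsUnit (1 + A) ∧
      ((1 - A) * (1 + A)⁻¹)ᵀ * ((1 - A) * (1 + A)⁻¹) = 1 ∧
      ((1 - A) * (1 + A)⁻¹) * ((1 - A) * (1 + A)⁻¹)ᵀ = 1 := by
  have hadd : IsUnit (1 + A) := isUnit_one_add_of_transpose_eq_neg hA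
  have htadd : (1 + A)ᵀ = 1 - A := by rw [transpose_add, transpose_one, hA, sub_eq_add_neg]
  have htsub : (1 - A)ᵀ = 1 + A := by rw [transpose_sub, transpose_one, hA, sub_neg_eq_add]
  have hdet : IsUnit (1 + A).det := (isUnit_iff_isUnit_det _).1 hadd
  have hdet' : IsUnit (1 - A).det := by rwa [← htadd, det_transpose]
  have hcomm : (1 + A) * (1 - A) = (1 - A) * (1 + A) := by noncomm_ring
  have hQ : ((1 - A) * (1 + A)⁻¹)ᵀ * ((1 - A) * (1 + A)⁻¹) = 1 := by
    calc ((1 - A) * (1 + A)⁻¹)ᵀ * ((1 - A) * (1 + A)⁻¹)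
        = (1 - A)⁻¹ * ((1 + A) * (1 - A)) * (1 + A)⁻¹ := by
          rw [transpose_mul, transpose_nonsing_inv, htadd, htsub]
          simp only [Matrix.mul_assoc]
      _ = 1 := by
          rw [hcomm, nonsing_inv_mul_cancel_left _ _ hdet', mul_nonsing_inv _ hdet]
  exact ⟨hadd, hQ, mul_eq_one_comm.1 hQ⟩
end

section
/- Let C be a square complex matrix all of whose entries are real, and let 𝓕 be a unitary complex matrix of the same size (𝓕*𝓕 = I). Set D = 𝓕 · C · 𝓕*. Then cayley(C) = 𝓕* · cayley(D) · 𝓕; moreover cayley(C) has all real entries and, viewed as a real matrix, is orthogonal (cayley(C)ᵀ · cayley(C) = I). -/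
open Matrix

/-- The Cayley transform of the skew-Hermitian part of a square complex matrix. -/
noncomputable def cayley {n : Type*} [Fintype n] [DecidableEq n] (B : Matrix n n ℂ) :
    Matrix n n ℂ :=
  (1 - B + Bᴴ) * (1 + B - Bᴴ)⁻¹

open scoped ComplexOrder in
theorem isUnit_det_one_add_sub_conjTranspose {n : Type*} [Fintype n] [DecidableEq n]
    (B : Matrix n n ℂ) : IsUnit (1 + B - Bᴴ).det := by
  have h : (1 + B - Bᴴ)ᴴ * (1 + B - Bᴴ) = 1 + (B - Bᴴ)ᴴ * (B - Bᴴ) := by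
    simp only [conjTranspose_sub, conjTranspose_add, conjTranspose_one,
      conjTranspose_conjTranspose]
    noncomm_ring
  have hpos : ((1 + B - Bᴴ)ᴴ * (1 + B - Bᴴ)).PosDef := by
    rw [h]
    exact PosDef.one.add_posSemidef (posSemidef_conjTranspose_mul_self _)
  have hdet := (isUnit_iff_isUnit_det _).mp hpos.isUnit
  rw [det_mul] at hdet
  exact isUnit_of_mul_isUnit_right hdet

theorem cayley_conjTranspose_mul_self {n : Type*} [Fintype n] [DecidableEq n]
    (B : Matrix n n ℂ) : (cayley B)ᴴ * cayley B = 1 := by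
  have hM := isUnit_det_one_add_sub_conjTranspose B
  have hadj : (1 + B - Bᴴ)ᴴ = 1 - B + Bᴴ := by
    simp only [conjTranspose_sub, conjTranspose_add, conjTranspose_one,
      conjTranspose_conjTranspose]
    abel
  have hN : IsUnit (1 - B + Bᴴ).det := by
    rw [← hadj, det_conjTranspose]
    exact hM.star
  have hadj' : (1 - B + Bᴴ)ᴴ = 1 + B - Bᴴ := by
    rw [← hadj, conjTranspose_conjTranspose]
  have hcomm : (1 + B - Bᴴ) * (1 - B + Bᴴ) = (1 - B + Bᴴ) * (1 + B - Bᴴ) := by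
    noncomm_ring
  rw [cayley, conjTranspose_mul, conjTranspose_nonsing_inv, hadj, hadj', Matrix.mul_assoc,
    ← Matrix.mul_assoc (1 + B - Bᴴ), hcomm, Matrix.mul_assoc, mul_nonsing_inv _ hM,
    Matrix.mul_one, nonsing_inv_mul _ hN]

theorem cayley_unitary_conj {n : Type*} [Fintype n] [DecidableEq n]
    (B U : Matrix n n ℂ) (hU : Uᴴ * U = 1) :
    cayley (U * B * Uᴴ) = U * cayley B * Uᴴ := by
  have hU' : U * Uᴴ = 1 := mul_eq_one_comm.mp hU
  have hM : 1 + U * B * Uᴴ - (U * B * Uᴴ)ᴴ = U * (1 + B - Bᴴ) * Uᴴ := by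
    simp only [conjTranspose_mul, conjTranspose_conjTranspose, Matrix.mul_add, Matrix.mul_sub,
      Matrix.add_mul, Matrix.sub_mul, Matrix.mul_one, hU', Matrix.mul_assoc]
  have hN : 1 - U * B * Uᴴ + (U * B * Uᴴ)ᴴ = U * (1 - B + Bᴴ) * Uᴴ := by
    simp only [conjTranspose_mul, conjTranspose_conjTranspose, Matrix.mul_add, Matrix.mul_sub,
      Matrix.add_mul, Matrix.sub_mul, Matrix.mul_one, hU', Matrix.mul_assoc]
  rw [cayley, hM, hN, Matrix.mul_inv_rev, Matrix.mul_inv_rev, inv_eq_left_inv hU, inv_eq_left_inv hU', cayley]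
  simp only [Matrix.mul_assoc]
  rw [← Matrix.mul_assoc Uᴴ U, hU, Matrix.one_mul]

theorem cayley_im_eq_zero {n : Type*} [Fintype n] [DecidableEq n]
    (B : Matrix n n ℂ) (hB : ∀ i j, (B i j).im = 0) (i j : n) : (cayley B i j).im = 0 := by
  have hconj : (starRingEnd ℂ).mapMatrix B = B := by
    ext i j
    exact Complex.conj_eq_iff_im.mpr (hB i j)
  have hconjT : (starRingEnd ℂ).mapMatrix Bᴴ = Bᴴ := by
    ext i j
    exact Complex.conj_eq_iff_im.mpr (by simp [hB])
  have hinv : (starRingEnd ℂ).mapMatrix (1 + B - Bᴴ)⁻¹ = (1 + B - Bᴴ)⁻¹ := by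
    refine (inv_eq_left_inv ?_).symm
    have h := congrArg (starRingEnd ℂ).mapMatrix
      (nonsing_inv_mul _ (isUnit_det_one_add_sub_conjTranspose B))
    rwa [map_mul, map_sub, map_add, map_one, hconj, hconjT] at h
  have h : (starRingEnd ℂ).mapMatrix (cayley B) = cayley B := by
    rw [cayley, map_mul, hinv, map_add, map_sub, map_one, hconj, hconjT]
  exact Complex.conj_eq_iff_im.mp (congrFun (congrFun h i) j)

/-- Theorem A.4 of the paper: applying the Cayley transform to the
Fourier-domain (block-diagonalized) representation `D = 𝓕 C 𝓕ᴴ` of a real matrix `C`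
yields `cayley C = 𝓕ᴴ (cayley D) 𝓕`, which is real and orthogonal. -/
theorem cayley_of_real_via_unitary {m : Type*} [Fintype m] [DecidableEq m]
    (C 𝓕 : Matrix m m ℂ)
    (hCreal : ∀ i j, (C i j).im = 0)
    (h𝓕 : 𝓕ᴴ * 𝓕 = 1)
    (D : Matrix m m ℂ) (hD : D = 𝓕 * C * 𝓕ᴴ) :
    cayley C = 𝓕ᴴ * cayley D * 𝓕 ∧
    (∀ i j, ((cayley C) i j).im = 0) ∧
    ((cayley C).map Complex.re)ᵀ * (cayley C).map Complex.re = 1 := by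
  have him := cayley_im_eq_zero C hCreal
  refine ⟨?_, him, ?_⟩
  · rw [hD, cayley_unitary_conj C 𝓕 h𝓕]
    simp only [Matrix.mul_assoc, h𝓕, Matrix.mul_one]
    rw [← Matrix.mul_assoc, h𝓕, Matrix.one_mul]
  · ext i j
    have h := congrArg Complex.re
      (congrFun (congrFun (cayley_conjTranspose_mul_self C) i) j)
    simpa [Matrix.mul_apply, him, Matrix.one_apply, apply_ite Complex.re] using h
end

section
/- Let U be a c×c complex matrix and V a d×c complex matrix. Set A = U − U* and K = I_c + A + V*V (which is invertible since A is skew-Hermitian and V*V is positive semidefinite). Define the (c+d)×c block matrix M whose top c×c block is (I_c − A − V*V)·K⁻¹ and whose bottom d×c block is −2·V·K⁻¹. Then M is semi-orthogonal: M* · M = I_c. -/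
open Matrix

open scoped ComplexOrder in
/-- A square complex matrix whose Hermitian part is positive definite is invertible. -/
theorem Matrix.isUnit_det_of_posDef_add_conjTranspose {n : Type*} [Fintype n] [DecidableEq n]
    {K : Matrix n n ℂ} (h : (K + Kᴴ).PosDef) : IsUnit K.det := by
  rw [isUnit_iff_ne_zero]
  intro h0
  obtain ⟨v, hv, hKv⟩ := Matrix.exists_mulVec_eq_zero_iff.mpr h0
  have hpos := h.dotProduct_mulVec_pos hv
  have hstar : star v ᵥ* Kᴴ = 0 := by rw [← Matrix.star_mulVec, hKv, star_zero]
  rw [Matrix.add_mulVec, hKv, zero_add, Matrix.dotProduct_mulVec, hstar, zero_dotProduct] at hpos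
  exact lt_irrefl _ hpos

open scoped ComplexOrder in
/-- If `A` is skew-Hermitian, then `1 + A + Vᴴ * V` is invertible. -/
theorem Matrix.isUnit_det_one_add_skew_add_conjTranspose_mul_self {m n : Type*} [Fintype m]
    [Fintype n] [DecidableEq n] {A : Matrix n n ℂ} (hA : Aᴴ = -A) (V : Matrix m n ℂ) :
    IsUnit (1 + A + Vᴴ * V).det := by
  apply Matrix.isUnit_det_of_posDef_add_conjTranspose
  have hsum : (1 + A + Vᴴ * V) + (1 + A + Vᴴ * V)ᴴ = (1 + Vᴴ * V) + (1 + Vᴴ * V) := by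
    rw [conjTranspose_add, conjTranspose_add, conjTranspose_one, conjTranspose_mul,
      conjTranspose_conjTranspose, hA]
    abel
  have hpos : (1 + Vᴴ * V).PosDef :=
    Matrix.PosDef.one.add_posSemidef (posSemidef_conjTranspose_mul_self V)
  rw [hsum]
  exact hpos.add hpos

/-- the Schur-complement form of the Cayley transform used for
semi-orthogonal convolutions is semi-orthogonal: `Mᴴ M = I`. -/
theorem schur_cayley_semiOrthogonal {c d : ℕ}
    (U : Matrix (Fin c) (Fin c) ℂ) (V : Matrix (Fin d) (Fin c) ℂ)
    (A : Matrix (Fin c) (Fin c) ℂ) (hA : A = U - Uᴴ)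
    (K : Matrix (Fin c) (Fin c) ℂ) (hK : K = 1 + A + Vᴴ * V)
    (M : Matrix (Fin c ⊕ Fin d) (Fin c) ℂ)
    (hM : M = Matrix.fromRows ((1 - A - Vᴴ * V) * K⁻¹) ((-2 : ℂ) • (V * K⁻¹))) :
    Mᴴ * M = 1 := by
  have hA' : Aᴴ = -A := by
    rw [hA, conjTranspose_sub, conjTranspose_conjTranspose, neg_sub]
  have hP : (Vᴴ * V)ᴴ = Vᴴ * V := by
    rw [conjTranspose_mul, conjTranspose_conjTranspose]
  have hKstar : Kᴴ = 1 - A + Vᴴ * V := by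
    rw [hK, conjTranspose_add, conjTranspose_add, conjTranspose_one, hA', hP, ← sub_eq_add_neg]
  have hdet : IsUnit K.det :=
    hK ▸ Matrix.isUnit_det_one_add_skew_add_conjTranspose_mul_self hA' V
  have hKinv : K * K⁻¹ = 1 := mul_nonsing_inv K hdet
  have hgram : (1 - A - Vᴴ * V)ᴴ * (1 - A - Vᴴ * V) + (4 : ℂ) • (Vᴴ * V) = Kᴴ * K := by
    rw [hKstar, hK, conjTranspose_sub, conjTranspose_sub, conjTranspose_one, hA', hP,
      show (4 : ℂ) • (Vᴴ * V) = (4 : Matrix (Fin c) (Fin c) ℂ) * (Vᴴ * V) by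
        rw [ofNat_smul_eq_nsmul, nsmul_eq_mul, Nat.cast_ofNat]]
    noncomm_ring
  calc Mᴴ * M
      = (K⁻¹)ᴴ * ((1 - A - Vᴴ * V)ᴴ * (1 - A - Vᴴ * V) + (4 : ℂ) • (Vᴴ * V)) * K⁻¹ := by
        rw [hM, conjTranspose_fromRows_eq_fromCols_conjTranspose, fromCols_mul_fromRows,
          conjTranspose_smul, conjTranspose_mul, conjTranspose_mul, Matrix.smul_mul,
          Matrix.mul_smul, smul_smul, Matrix.mul_add, Matrix.add_mul, Matrix.mul_smul,
          Matrix.smul_mul]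
        simp only [Matrix.mul_assoc]
        norm_num
    _ = (K * K⁻¹)ᴴ * (K * K⁻¹) := by
        rw [hgram, conjTranspose_mul]
        simp only [Matrix.mul_assoc]
    _ = 1 := by rw [hKinv, conjTranspose_one, Matrix.one_mul]
end

section
/- Let U be a c×c complex matrix and V a d×c complex matrix, and let W be the (c+d)×(c+d) block matrix with top-left block U, bottom-left block V, and both right blocks zero (i.e., W = [U 0; V 0]). Let P be the (c+d)×c matrix [I_c; 0]. Set A = U − U* and K = I_c + A + V*V. Then cayley(W) · P equals the (c+d)×c block matrix whose top c×c block is (I_c − A − V*V)·K⁻¹ and whose bottom d×c block is −2·V·K⁻¹. -/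
open Matrix

open scoped ComplexOrder in
theorem Matrix.PosDef.isUnit_add_of_conjTranspose_eq_neg {n 𝕜 : Type*} [Fintype n] [DecidableEq n]
    [RCLike 𝕜] {H S : Matrix n n 𝕜} (hH : H.PosDef) (hS : Sᴴ = -S) : IsUnit (H + S) := by
  rw [← mulVec_injective_iff_isUnit]
  refine (injective_iff_map_eq_zero (H + S).mulVecLin).2 fun x hx => ?_
  rw [mulVecLin_apply] at hx
  by_contra hx0
  have h₁ : star x ⬝ᵥ (H *ᵥ x) + star x ⬝ᵥ (S *ᵥ x) = 0 := by
    rw [← dotProduct_add, ← add_mulVec, hx, dotProduct_zero]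
  have h₂ : star x ⬝ᵥ (H *ᵥ x) - star x ⬝ᵥ (S *ᵥ x) = 0 := by
    rw [← dotProduct_sub, ← sub_mulVec, sub_eq_add_neg, ← hS]
    nth_rw 1 [← hH.isHermitian.eq]
    rw [← conjTranspose_add, dotProduct_mulVec, ← star_mulVec, hx, star_zero, zero_dotProduct]
  refine (hH.dotProduct_mulVec_pos hx0).ne' ?_
  linear_combination (h₁ + h₂) / 2

open scoped ComplexOrder in
theorem Matrix.isUnit_one_add_add_conjTranspose_mul_self {m n 𝕜 : Type*} [Fintype m] [Fintype n]
    [DecidableEq n] [RCLike 𝕜] {S : Matrix n n 𝕜} (hS : Sᴴ = -S) (V : Matrix m n 𝕜) :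
    IsUnit (1 + S + Vᴴ * V) := by
  rw [add_right_comm]
  exact (PosDef.one.add_posSemidef
    (posSemidef_conjTranspose_mul_self V)).isUnit_add_of_conjTranspose_eq_neg hS

/-- the first `c` columns of the Cayley transform of the zero-padded matrix
`[U 0; V 0]` equal the Schur-complement block form `[(I − A − VᴴV)K⁻¹; −2VK⁻¹]`. -/
theorem cayley_padded_eq_schur_form {c d : ℕ}
    (U : Matrix (Fin c) (Fin c) ℂ) (V : Matrix (Fin d) (Fin c) ℂ)
    (W : Matrix (Fin c ⊕ Fin d) (Fin c ⊕ Fin d) ℂ)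
    (hW : W = Matrix.fromBlocks U 0 V 0)
    (P : Matrix (Fin c ⊕ Fin d) (Fin c) ℂ)
    (hP : P = Matrix.fromRows (1 : Matrix (Fin c) (Fin c) ℂ) (0 : Matrix (Fin d) (Fin c) ℂ))
    (A : Matrix (Fin c) (Fin c) ℂ) (hA : A = U - Uᴴ)
    (K : Matrix (Fin c) (Fin c) ℂ) (hK : K = 1 + A + Vᴴ * V) :
    cayley W * P = Matrix.fromRows ((1 - A - Vᴴ * V) * K⁻¹) ((-2 : ℂ) • (V * K⁻¹)) := by
  subst hW hP
  have hA' : Aᴴ = -A := by simp [hA]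
  have hK' : IsUnit K.det := by
    rw [← isUnit_iff_isUnit_det, hK]
    exact isUnit_one_add_add_conjTranspose_mul_self hA' V
  set W : Matrix (Fin c ⊕ Fin d) (Fin c ⊕ Fin d) ℂ := fromBlocks U 0 V 0 with hW
  have hM' : IsUnit (1 + W - Wᴴ).det := by
    rw [← isUnit_iff_isUnit_det, add_sub_assoc]
    simpa using isUnit_one_add_add_conjTranspose_mul_self (S := W - Wᴴ) (by simp)
      (0 : Matrix (Fin c) (Fin c ⊕ Fin d) ℂ)
  have hM : 1 + W - Wᴴ = fromBlocks (1 + A) (-Vᴴ) V 1 := by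
    rw [hW, hA, ← fromBlocks_one, fromBlocks_conjTranspose, sub_eq_add_neg, fromBlocks_neg,
      fromBlocks_add, fromBlocks_add]
    simp [add_assoc, sub_eq_add_neg]
  have hN : 1 - W + Wᴴ = fromBlocks (1 - A) Vᴴ (-V) 1 := by
    rw [hW, hA, ← fromBlocks_one, fromBlocks_conjTranspose, sub_eq_add_neg, fromBlocks_neg,
      fromBlocks_add, fromBlocks_add]
    simp [sub_eq_add_neg, add_assoc, add_comm Uᴴ]
  have hP : (1 + W - Wᴴ)⁻¹ * fromRows (1 : Matrix (Fin c) (Fin c) ℂ)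
      (0 : Matrix (Fin d) (Fin c) ℂ) = fromRows K⁻¹ (-(V * K⁻¹)) := by
    have h : (1 + W - Wᴴ) * fromRows K⁻¹ (-(V * K⁻¹)) = fromRows 1 0 := by
      rw [hM, fromBlocks_mul_fromRows]
      congr 1
      · rw [Matrix.neg_mul, Matrix.mul_neg, neg_neg, ← Matrix.mul_assoc, ← Matrix.add_mul, ← hK,
          mul_nonsing_inv _ hK']
      · rw [Matrix.one_mul, add_neg_cancel]
    rw [← h, nonsing_inv_mul_cancel_left _ _ hM']
  rw [cayley, Matrix.mul_assoc, hP, hN, fromBlocks_mul_fromRows]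
  congr 1
  · rw [Matrix.mul_neg, ← Matrix.mul_assoc, ← sub_eq_add_neg, ← Matrix.sub_mul]
  · rw [Matrix.neg_mul, Matrix.one_mul, neg_smul, two_smul, neg_add]
end

section
/- For any square complex matrix B, the Cayley transform commutes with transposition: cayley(Bᵀ) = cayley(B)ᵀ, where Bᵀ denotes the (non-conjugated) transpose. -/
open Matrix

/-- Matrices that commute still commute after one of them is inverted. -/
theorem Matrix.commute_nonsing_inv_right {n R : Type*} [Fintype n] [DecidableEq n] [CommRing R]
    {A M : Matrix n n R} (h : Commute A M) : Commute A M⁻¹ := by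
  by_cases hM : IsUnit M.det
  · have := M.invertibleOfIsUnitDet hM
    rw [← invOf_eq_nonsing_inv]
    exact h.invOf_right
  · rw [nonsing_inv_apply_not_isUnit M hM]
    exact Commute.zero_right A

/-- the Cayley transform commutes with (non-conjugated) transposition. -/
theorem cayley_transpose {n : Type*} [Fintype n] [DecidableEq n] (B : Matrix n n ℂ) :
    cayley Bᵀ = (cayley B)ᵀ := by
  have hcomm : Commute (1 - B + Bᴴ) (1 + B - Bᴴ) := by
    rw [commute_iff_eq]
    noncomm_ring
  have hstar : Bᵀᴴ = Bᴴᵀ := rfl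
  rw [cayley, cayley, (Matrix.commute_nonsing_inv_right hcomm).eq, transpose_mul,
    transpose_nonsing_inv, hstar]
  simp only [transpose_add, transpose_sub, transpose_one]
end
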